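/- arXiv:math/0005250 — 2 statements merged into one kernel-verified Lean document; each statement's English description precedes it below -/
import Mathlib

section
/- Noncommutative Beurling theorem: if A is a trace-class operator on H with trace(A W_ζ) = 0 for some ζ ∈ ℝ², then there exist trace-class operators A_n and open neighborhoods U_n of ζ such that trace(A_n W_z) = 0 for all z ∈ U_n and trace|A − A_n| → 0 as n → ∞. -/
open MeasureTheory Complex Filter
open scoped ComplexOrder

noncomputable section

/-- The symplectic form `ω((x,y),(x',y')) = (x'y − xy')/2` on `ℝ²`. -/
def symp (z w : ℝ × ℝ) : ℝ := (w.1 * z.2 - z.1 * w.2) / 2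

variable (H : Type) [NormedAddCommGroup H] [InnerProductSpace ℂ H] [CompleteSpace H]

/-- A Weyl system: a strongly continuous family of unitaries satisfying the Weyl relation. -/
structure WeylSystem where
  W : ℝ × ℝ → H →L[ℂ] H
  unitary_mem : ∀ z, W z ∈ unitary (H →L[ℂ] H)
  strong_cont : ∀ f : H, Continuous fun z => W z f
  weyl : ∀ z₁ z₂, W z₁ * W z₂ = Complex.exp (Complex.I * (symp z₁ z₂ : ℂ)) • W (z₁ + z₂)

variable {H}

/-- Irreducibility: any operator commuting with all the `W z` is a scalar. -/
def WeylSystem.Irreducible (S : WeylSystem H) : Prop :=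
  ∀ T : H →L[ℂ] H, (∀ z, T * S.W z = S.W z * T) → ∃ c : ℂ, T = c • (1 : H →L[ℂ] H)

/-- Conjugation `A ↦ W_{ζ/√2} A W_{ζ/√2}*`. -/
def WeylSystem.conj (S : WeylSystem H) (ζ : ℝ × ℝ) (A : H →L[ℂ] H) : H →L[ℂ] H :=
  S.W ((Real.sqrt 2)⁻¹ • ζ) * A * star (S.W ((Real.sqrt 2)⁻¹ • ζ))

/-- Normal (weak-* continuous) linear functionals on `B(H)`. -/
def IsNormalFunctional (ρ : (H →L[ℂ] H) → ℂ) : Prop :=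
  ∃ ξ η : ℕ → H, Summable (fun n => ‖ξ n‖ * ‖η n‖) ∧
    ∀ A : H →L[ℂ] H, ρ A = ∑' n, @inner ℂ _ _ (A (ξ n)) (η n)

/-- Normal states on `B(H)`. -/
def IsNormalState (ρ : (H →L[ℂ] H) → ℂ) : Prop :=
  IsNormalFunctional ρ ∧ (∀ A : H →L[ℂ] H, 0 ≤ ρ (star A * A)) ∧ ρ 1 = 1

/-- The norm of a (bounded) linear functional on `B(H)`. -/
def funcNorm (ρ : (H →L[ℂ] H) → ℂ) : ℝ :=
  ⨆ A : {A : H →L[ℂ] H // ‖A‖ ≤ 1}, ‖ρ A.1‖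

/-- The Gaussian probability measure `μ_t` on `ℝ²`, with density `(πt)⁻¹ e^{−(x²+y²)/(4t)}`,
whose symplectic Fourier transform is `e^{−t|z|²}`. -/
def gaussMeasure (t : ℝ) : Measure (ℝ × ℝ) :=
  volume.withDensity fun p => ENNReal.ofReal ((Real.pi * t)⁻¹ * Real.exp (-(p.1 ^ 2 + p.2 ^ 2) / (4 * t)))

/-- `Φ` is the CCR heat flow semigroup: `Φ 0` is the identity and for `t > 0`, `Φ t` is given by
the weak integral `Φ t A = ∫ W_{ζ/√2} A W_{ζ/√2}* dμ_t(ζ)` against the Gaussian measure. -/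
def IsHeatFlow (S : WeylSystem H) (Φ : ℝ → (H →L[ℂ] H) → (H →L[ℂ] H)) : Prop :=
  Φ 0 = id ∧ ∀ t > 0, ∀ (A : H →L[ℂ] H) (ξ η : H),
    @inner ℂ _ _ ((Φ t A) ξ) η = ∫ ζ, @inner ℂ _ _ ((S.conj ζ A) ξ) η ∂(gaussMeasure t)

section ProjectiveTensor

set_option linter.unusedSectionVars false

open scoped Classical in
/-- A continuous linear map on `ℓ¹(ι; H)` from a uniformly bounded family of maps on `H`. -/
def lpOneLift {ι F : Type*} [NormedAddCommGroup F] [NormedSpace ℂ F] [CompleteSpace F]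
    (L : ι → H →L[ℂ] F) (C : ℝ) (hL : ∀ x, ‖L x‖ ≤ C) :
    lp (fun _ : ι => H) 1 →L[ℂ] F :=
  have hs : ∀ a : lp (fun _ : ι => H) 1, HasSum (fun x => ‖a x‖) ‖a‖ := fun a => by
    simpa using lp.hasSum_norm (p := 1) (by simp) a
  have hb : ∀ (a : lp (fun _ : ι => H) 1) (x : ι), ‖L x (a x)‖ ≤ C * ‖a x‖ := fun a x =>
    (L x).le_of_opNorm_le (hL x) _
  have hsum : ∀ a : lp (fun _ : ι => H) 1, Summable fun x => L x (a x) := fun a =>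
    .of_norm_bounded ((hs a).summable.mul_left C) (hb a)
  LinearMap.mkContinuous
    { toFun := fun a => ∑' x, L x (a x)
      map_add' := fun a b => by
        rw [← (hsum a).tsum_add (hsum b)]
        simp
      map_smul' := fun c a => by
        simp [tsum_const_smul''] } C fun a =>
    tsum_of_norm_bounded ((hs a).mul_left C) (hb a)

open scoped Classical in
theorem lpOneLift_single {ι F : Type*} [NormedAddCommGroup F] [NormedSpace ℂ F] [CompleteSpace F]
    (L : ι → H →L[ℂ] F) (C : ℝ) (hL : ∀ x, ‖L x‖ ≤ C) (x : ι) (y : H) :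
    lpOneLift L C hL (lp.single 1 x y) = L x y := by
  change ∑' i, L i ((lp.single 1 x y : lp (fun _ : ι => H) 1) i) = _
  rw [tsum_eq_single x]
  · simp
  · intro i hi
    simp [hi]

variable (H) in
/-- The space `ℓ¹(H; H)`, whose element `a` encodes the formal sum of the elementary tensors
`‖x‖⁻¹ x ⊗ a x`. -/
abbrev FormalNuclear : Type := lp (fun _ : H => H) 1

open scoped Classical in
/-- The formal elementary tensor `x ⊗ y`. -/
def formalTensor (x y : H) : FormalNuclear H := lp.single 1 x ((‖x‖ : ℂ) • y)

variable (H) in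
open scoped Classical in
/-- The closed span of the relations making `x ⊗ y` conjugate-linear in `x`. -/
def nuclearRel : Submodule ℂ (FormalNuclear H) :=
  (Submodule.span ℂ
    ({r | ∃ x x' y, r = formalTensor (x + x') y - (formalTensor x y + formalTensor x' y)} ∪
     {r | ∃ (c : ℂ) (x y : H), r = formalTensor (c • x) y - star c • formalTensor x y} ∪
     {r | ∃ y : H, r = lp.single 1 0 y})).topologicalClosure

instance : IsClosed (nuclearRel H : Set (FormalNuclear H)) :=
  Submodule.isClosed_topologicalClosure _

variable (H) in
/-- The completed projective tensor product of the conjugate of `H` with `H`. -/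
abbrev NuclearSpace : Type := FormalNuclear H ⧸ nuclearRel H

/-- The elementary tensor `x ⊗ y`, standing for the operator `⟨x, ·⟩ y`. -/
def tens (x y : H) : NuclearSpace H := (nuclearRel H).mkQL (formalTensor x y)

theorem norm_tens_le (x y : H) : ‖tens x y‖ ≤ ‖x‖ * ‖y‖ := by
  classical
  refine (Submodule.Quotient.norm_mk_le _ _).trans ?_
  rw [formalTensor, lp.norm_single (by simp)]
  simp [norm_smul]

theorem tens_add_left (x x' y : H) : tens (x + x') y = tens x y + tens x' y := by
  rw [tens, tens, tens, ← map_add, ← sub_eq_zero, ← map_sub]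
  refine (Submodule.Quotient.mk_eq_zero _).2 (Submodule.le_topologicalClosure _ ?_)
  exact Submodule.subset_span (.inl (.inl ⟨x, x', y, rfl⟩))

theorem tens_smul_left (c : ℂ) (x y : H) : tens (c • x) y = star c • tens x y := by
  rw [tens, tens, ← map_smul, ← sub_eq_zero, ← map_sub]
  refine (Submodule.Quotient.mk_eq_zero _).2 (Submodule.le_topologicalClosure _ ?_)
  exact Submodule.subset_span (.inl (.inr ⟨c, x, y, rfl⟩))

theorem tens_add_right (x y y' : H) : tens x (y + y') = tens x y + tens x y' := by
  simp [tens, formalTensor, lp.single_add]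

theorem tens_smul_right (c : ℂ) (x y : H) : tens x (c • y) = c • tens x y := by
  rw [tens, tens, ← map_smul]
  simp only [formalTensor, smul_comm _ c y, lp.single_smul]

/-- `y ↦ x ⊗ y` as a continuous linear map. -/
def tensRight (x : H) : H →L[ℂ] NuclearSpace H :=
  LinearMap.mkContinuous
    { toFun := tens x
      map_add' := tens_add_right x
      map_smul' := fun c y => tens_smul_right c x y } ‖x‖ (norm_tens_le x)

@[simp]
theorem tensRight_apply (x y : H) : tensRight x y = tens x y := rfl

theorem norm_tensRight_le (x : H) : ‖tensRight x‖ ≤ ‖x‖ :=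
  LinearMap.mkContinuous_norm_le _ (norm_nonneg _) _

/-- `x ⊗ y` as a bounded sesquilinear map. -/
def tensSL : H →L⋆[ℂ] H →L[ℂ] NuclearSpace H :=
  LinearMap.mkContinuous (σ := starRingEnd ℂ)
    { toFun := fun x : H => tensRight x
      map_add' := fun x x' => by
        refine ContinuousLinearMap.ext fun y => ?_
        simp [tens_add_left]
      map_smul' := fun c x => by
        refine ContinuousLinearMap.ext fun y => ?_
        simp [tens_smul_left] } 1 fun x =>
    (norm_tensRight_le x).trans_eq (one_mul _).symm

@[simp]
theorem tensSL_apply (x y : H) : tensSL x y = tens x y := rfl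

theorem exists_hasSum_tens (b : NuclearSpace H) {δ : ℝ} (hδ : 0 < δ) :
    ∃ ξ η : ℕ → H, Summable (fun n => ‖ξ n‖ * ‖η n‖) ∧
      ∑' n, ‖ξ n‖ * ‖η n‖ ≤ ‖b‖ + δ ∧ HasSum (fun n => tens (ξ n) (η n)) b := by
  classical
  obtain ⟨a, rfl, ha⟩ := Submodule.Quotient.norm_mk_lt b hδ
  have hs : HasSum (fun x => ‖a x‖) ‖a‖ := by
    simpa using lp.hasSum_norm (p := 1) (by simp) a
  have hc : (Function.support a).Countable := by
    have := hs.summable.countable_support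
    simpa [Function.support] using this
  obtain ⟨f, hf⟩ := @Countable.exists_injective_nat (Function.support a) hc.to_subtype
  set X : Function.support a → H := fun x => x
  set Y : Function.support a → H := fun x => (‖(x : H)‖⁻¹ : ℂ) • a x
  have hcases : ∀ n, (∃ x, f x = n) ∨ ¬ ∃ x, f x = n := fun n => em _
  have h1 : ∀ x : H, ‖x‖ * ‖(‖x‖⁻¹ : ℂ) • a x‖ ≤ ‖a x‖ := fun x => by
    by_cases hx : x = 0
    · simp [hx]
    · rw [norm_smul, ← mul_assoc]
      simp [hx]
  have h2 : ∀ x : H, tens x ((‖x‖⁻¹ : ℂ) • a x) =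
      (nuclearRel H).mkQL (lp.single 1 x (a x)) := fun x => by
    by_cases hx : x = 0
    · subst hx
      have : (nuclearRel H).mkQL (lp.single 1 0 (a 0)) = 0 :=
        (Submodule.Quotient.mk_eq_zero _).2 (Submodule.le_topologicalClosure _
          (Submodule.subset_span (.inr ⟨_, rfl⟩)))
      rw [this]
      simp [tens, formalTensor]
    · rw [tens, formalTensor, smul_smul, mul_inv_cancel₀ (by simpa using hx), one_smul]
  have hn : (fun n => ‖Function.extend f X 0 n‖ * ‖Function.extend f Y 0 n‖) =
      Function.extend f (fun x => ‖X x‖ * ‖Y x‖) 0 := by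
    ext n
    rcases hcases n with ⟨x, rfl⟩ | h
    · simp [hf.extend_apply]
    · simp [Function.extend_apply' _ _ _ h]
  have ht : (fun n => tens (Function.extend f X 0 n) (Function.extend f Y 0 n)) =
      Function.extend f (fun x => tens (X x) (Y x)) 0 := by
    ext n
    rcases hcases n with ⟨x, rfl⟩ | h
    · simp [hf.extend_apply]
    · simp [Function.extend_apply' _ _ _ h, tens, formalTensor]
  have hs' : HasSum (fun x : Function.support a => ‖a x‖) ‖a‖ := by
    refine (hasSum_subtype_iff_of_support_subset (f := fun x => ‖a x‖) ?_).2 hs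
    intro x
    simp
  have hS : Summable fun x => ‖X x‖ * ‖Y x‖ :=
    .of_nonneg_of_le (fun _ => by positivity) (fun x => h1 x) hs'.summable
  refine ⟨Function.extend f X 0, Function.extend f Y 0, ?_, ?_, ?_⟩
  · rw [hn]
    exact ((hasSum_extend_zero hf).2 hS.hasSum).summable
  · rw [hn, ((hasSum_extend_zero hf).2 hS.hasSum).tsum_eq]
    exact (hasSum_le (f := fun x => ‖X x‖ * ‖Y x‖) (fun x => h1 x) hS.hasSum hs').trans ha.le
  · rw [ht, hasSum_extend_zero hf]
    have := (lp.hasSum_single (p := 1) (by simp) a).mapL (nuclearRel H).mkQL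
    refine (hasSum_subtype_iff_of_support_subset
      (f := fun x : H => tens x ((‖x‖⁻¹ : ℂ) • a x)) ?_).2 ?_
    · intro x
      contrapose!
      intro hx
      simp [Function.notMem_support.1 hx, tens, formalTensor]
    · simp only [h2]
      exact this

theorem NuclearSpace.ext_tens {F : Type*} [NormedAddCommGroup F] [NormedSpace ℂ F]
    {f g : NuclearSpace H →L[ℂ] F} (h : ∀ x y, f (tens x y) = g (tens x y)) : f = g := by
  ext1 b
  obtain ⟨ξ, η, -, -, hb⟩ := exists_hasSum_tens b one_pos
  have h1 := hb.mapL f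
  simp only [h] at h1
  exact h1.unique (hb.mapL g)

open scoped Classical in
theorem nuclearRel_le_ker {F : Type*} [NormedAddCommGroup F] [NormedSpace ℂ F]
    (β : H →L⋆[ℂ] H →L[ℂ] F) (Φ : FormalNuclear H →L[ℂ] F)
    (hΦ : ∀ x y, Φ (lp.single 1 x y) = (‖x‖⁻¹ : ℂ) • β x y) : nuclearRel H ≤ Φ.ker := by
  have h0 : ∀ x y, Φ (formalTensor x y) = β x y := fun x y => by
    rw [formalTensor, hΦ]
    by_cases hx : x = 0
    · simp [hx]
    · rw [map_smul, smul_smul, inv_mul_cancel₀ (by simpa using hx), one_smul]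
  refine Submodule.topologicalClosure_minimal _ (Submodule.span_le.2 ?_) Φ.isClosed_ker
  rintro _ ((⟨x, x', y, rfl⟩ | ⟨c, x, y, rfl⟩) | ⟨y, rfl⟩)
  · simp [h0]
  · simp [h0]
  · simp [hΦ]

theorem norm_inv_smul_le {F : Type*} [NormedAddCommGroup F] [NormedSpace ℂ F]
    (β : H →L⋆[ℂ] H →L[ℂ] F) (x : H) : ‖(‖x‖⁻¹ : ℂ) • β x‖ ≤ ‖β‖ := by
  by_cases hx : x = 0
  · simp [hx, norm_nonneg β]
  · rw [norm_smul]
    have := β.le_opNorm x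
    have hx' : 0 < ‖x‖ := by simpa using hx
    simp only [norm_inv, norm_real, norm_norm]
    rw [inv_mul_le_iff₀ hx', mul_comm]
    exact this

open scoped Classical in
/-- Universal property: a bounded sesquilinear map factors through the projective tensor
product. -/
def nuclearLift {F : Type*} [NormedAddCommGroup F] [NormedSpace ℂ F] [CompleteSpace F]
    (β : H →L⋆[ℂ] H →L[ℂ] F) : NuclearSpace H →L[ℂ] F :=
  (nuclearRel H).liftQL (lpOneLift (fun x => (‖x‖⁻¹ : ℂ) • β x) ‖β‖ (norm_inv_smul_le β))
    (nuclearRel_le_ker β _ fun x y => by simp [lpOneLift_single])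

@[simp]
theorem nuclearLift_tens {F : Type*} [NormedAddCommGroup F] [NormedSpace ℂ F] [CompleteSpace F]
    (β : H →L⋆[ℂ] H →L[ℂ] F) (x y : H) : nuclearLift β (tens x y) = β x y := by
  classical
  change lpOneLift (fun x => (‖x‖⁻¹ : ℂ) • β x) ‖β‖ (norm_inv_smul_le β) (formalTensor x y) = _
  rw [formalTensor, lpOneLift_single]
  by_cases hx : x = 0
  · simp [hx]
  · rw [smul_apply, map_smul, smul_smul,
      inv_mul_cancel₀ (by simpa using hx), one_smul]

end ProjectiveTensor

section FlowAverage

open scoped SchwartzMap FourierTransform Topology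

set_option linter.unusedSectionVars false

theorem tendsto_integral_norm_translate_sub (φ : 𝓢(ℝ, ℂ)) :
    Tendsto (fun h : ℝ => ∫ u, ‖φ (u - h) - φ u‖) (𝓝 0) (𝓝 0) := by
  obtain ⟨C, hC, hC'⟩ := φ.decay 0 0
  obtain ⟨D, hD, hD'⟩ := φ.decay 2 0
  simp only [pow_zero, one_mul, norm_iteratedFDeriv_zero] at hC' hD'
  have hdom : ∀ h : ℝ, |h| ≤ 1 → ∀ u, ‖φ (u - h)‖ ≤ (3 * C + 2 * D) * (1 + u ^ 2)⁻¹ := by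
    intro h hh u
    rw [← div_eq_mul_inv, le_div_iff₀ (by positivity)]
    have h1 := hC' (u - h)
    have h2 := hD' (u - h)
    rw [Real.norm_eq_abs, sq_abs] at h2
    have h3 : h ^ 2 ≤ 1 := by rwa [sq_le_one_iff_abs_le_one]
    have h4 : 1 + u ^ 2 ≤ 3 + 2 * (u - h) ^ 2 := by nlinarith [sq_nonneg (u - 2 * h)]
    have := mul_le_mul_of_nonneg_left h4 (norm_nonneg (φ (u - h)))
    nlinarith
  have hlim : Tendsto (fun h : ℝ => ∫ u, ‖φ (u - h) - φ u‖) (𝓝 0) (𝓝 (∫ _ : ℝ, (0 : ℝ))) := by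
    refine tendsto_integral_filter_of_dominated_convergence
      (fun u => 2 * ((3 * C + 2 * D) * (1 + u ^ 2)⁻¹)) ?_ ?_ ?_ ?_
    · refine .of_forall fun h => Continuous.aestronglyMeasurable ?_
      have := φ.continuous
      fun_prop
    · filter_upwards [Metric.closedBall_mem_nhds (0 : ℝ) one_pos] with h hh
      refine .of_forall fun u => ?_
      have h1 := hdom h (by simpa using hh) u
      have h2 := hdom 0 (by simp) u
      rw [sub_zero] at h2
      rw [norm_norm]
      linarith [norm_sub_le (φ (u - h)) (φ u)]
    · exact (integrable_inv_one_add_sq.const_mul _).const_mul _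
    · refine .of_forall fun u => ?_
      have hc : Continuous fun h : ℝ => ‖φ (u - h) - φ u‖ := by
        have := φ.continuous
        fun_prop
      simpa using hc.tendsto 0
  simpa using hlim

/-- A Schwartz function whose Fourier transform is identically `1` near the origin. -/
theorem exists_schwartz_integral_mul_exp_eq_one :
    ∃ φ : 𝓢(ℝ, ℂ), ∀ κ : ℝ, |κ| ≤ 1 → ∫ u, φ u * Complex.exp (Complex.I * (u * κ : ℝ)) = 1 := by
  let b : ContDiffBump (0 : ℝ) := ⟨1, 2, one_pos, one_lt_two⟩
  have hs : HasCompactSupport fun x => ((b x : ℝ) : ℂ) :=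
    b.hasCompactSupport.comp_left (g := fun r : ℝ => (r : ℂ)) rfl
  have hd : ContDiff ℝ ((⊤ : ℕ∞) : WithTop ℕ∞) fun x => ((b x : ℝ) : ℂ) :=
    Complex.ofRealCLM.contDiff.comp b.contDiff
  let g : 𝓢(ℝ, ℂ) := hs.toSchwartzMap hd
  refine ⟨𝓕⁻ g, fun κ hκ => ?_⟩
  have h1 : (𝓕 (𝓕⁻ g)) (-κ / (2 * Real.pi)) = 1 := by
    rw [FourierTransform.fourier_fourierInv_eq]
    change ((b (-κ / (2 * Real.pi)) : ℝ) : ℂ) = 1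
    rw [b.one_of_mem_closedBall, ofReal_one]
    have hpi := Real.pi_gt_three
    rw [mem_closedBall_zero_iff, Real.norm_eq_abs, abs_div, abs_neg,
      abs_of_pos (by positivity : 0 < 2 * Real.pi)]
    exact (div_le_one (by positivity)).2 (by linarith)
  rw [SchwartzMap.fourier_coe, Real.fourier_real_eq_integral_exp_smul] at h1
  rw [← h1]
  congr 1
  ext u
  rw [smul_eq_mul, mul_comm]
  congr 2
  push_cast
  have : (Real.pi : ℂ) ≠ 0 := by exact_mod_cast Real.pi_ne_zero
  field_simp

variable {X : Type*} [NormedAddCommGroup X] [NormedSpace ℂ X] [CompleteSpace X]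

/-- A strongly continuous one-parameter semigroup of contractions, indexed by `ℝ`. -/
structure IsContractionFlow (U : ℝ → X →L[ℂ] X) : Prop where
  cont : ∀ x, Continuous fun t => U t x
  norm_le : ∀ t x, ‖U t x‖ ≤ ‖x‖
  add : ∀ s t x, U (s + t) x = U s (U t x)

variable {U V : ℝ → X →L[ℂ] X}

theorem IsContractionFlow.integrable (hU : IsContractionFlow U) (φ : 𝓢(ℝ, ℂ)) (R : ℝ) (x : X) :
    Integrable fun u => φ u • U (R * u) x := by
  refine (φ.integrable.norm.mul_const ‖x‖).mono' ?_ (.of_forall fun u => ?_)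
  · have h1 := φ.continuous
    have h2 := (hU.cont x).comp (continuous_const_mul R)
    exact (h1.smul h2).aestronglyMeasurable
  · rw [norm_smul]
    gcongr
    exact hU.norm_le _ _

/-- The average `∫ φ(u) U_{Ru} du` of a flow. -/
def IsContractionFlow.avg (hU : IsContractionFlow U) (φ : 𝓢(ℝ, ℂ)) (R : ℝ) : X →L[ℂ] X :=
  LinearMap.mkContinuous
    { toFun := fun x => ∫ u, φ u • U (R * u) x
      map_add' := fun x y => by
        rw [← integral_add (hU.integrable φ R x) (hU.integrable φ R y)]
        simp
      map_smul' := fun c x => by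
        rw [RingHom.id_apply, ← integral_smul]
        simp [smul_comm c] } (∫ u, ‖φ u‖) fun x => by
    change ‖∫ u, φ u • U (R * u) x‖ ≤ _
    rw [← integral_mul_const]
    refine norm_integral_le_of_norm_le (φ.integrable.norm.mul_const ‖x‖) (.of_forall fun u => ?_)
    rw [norm_smul]
    gcongr
    exact hU.norm_le _ _

theorem IsContractionFlow.avg_apply (hU : IsContractionFlow U) (φ : 𝓢(ℝ, ℂ)) (R : ℝ) (x : X) :
    hU.avg φ R x = ∫ u, φ u • U (R * u) x := rfl

theorem IsContractionFlow.norm_avg_apply_le (hU : IsContractionFlow U) (φ : 𝓢(ℝ, ℂ)) (R : ℝ)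
    (x : X) : ‖hU.avg φ R x‖ ≤ (∫ u, ‖φ u‖) * ‖x‖ :=
  (hU.avg φ R).le_of_opNorm_le
    (LinearMap.mkContinuous_norm_le _ (integral_nonneg fun _ => norm_nonneg _) _) x

theorem IsContractionFlow.avg_comm (hU : IsContractionFlow U) (φ : 𝓢(ℝ, ℂ)) (R : ℝ)
    (T : X →L[ℂ] X) (hT : ∀ t x, T (U t x) = U t (T x)) (x : X) :
    T (hU.avg φ R x) = hU.avg φ R (T x) := by
  rw [avg_apply, avg_apply, ← T.integral_comp_comm (hU.integrable φ R x)]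
  simp [hT]

theorem IsContractionFlow.map_avg_of_eigen (hU : IsContractionFlow U) (φ : 𝓢(ℝ, ℂ)) (R : ℝ)
    (f : X →L[ℂ] ℂ) (κ : ℝ) (hf : ∀ t x, f (U t x) = Complex.exp (Complex.I * (t * κ : ℝ)) * f x)
    (x : X) :
    f (hU.avg φ R x) = (∫ u, φ u * Complex.exp (Complex.I * (u * (R * κ) : ℝ))) * f x := by
  rw [avg_apply, ← f.integral_comp_comm (hU.integrable φ R x), ← integral_mul_const]
  congr 1
  ext u
  rw [map_smul, hf, smul_eq_mul, ← mul_assoc]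
  congr 5
  ring

theorem IsContractionFlow.norm_avg_sub_le (hU : IsContractionFlow U) (φ : 𝓢(ℝ, ℂ)) {R : ℝ}
    (hR : R ≠ 0) (s : ℝ) (x : X) :
    ‖hU.avg φ R (U s x - x)‖ ≤ (∫ u, ‖φ (u - s / R) - φ u‖) * ‖x‖ := by
  have h1 : hU.avg φ R (U s x) = ∫ u, φ (u - s / R) • U (R * u) x := by
    rw [avg_apply, ← integral_sub_right_eq_self _ (s / R)]
    congr 1
    ext u
    rw [← hU.add, mul_sub, mul_div_cancel₀ _ hR, sub_add_cancel]
  have hi : Integrable fun u => φ (u - s / R) := φ.integrable.comp_sub_right (s / R)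
  have hint : Integrable fun u => φ (u - s / R) • U (R * u) x := by
    have := (hU.integrable φ R (U s x)).comp_sub_right (s / R)
    refine this.congr (.of_forall fun u => ?_)
    dsimp only
    rw [← hU.add, mul_sub, mul_div_cancel₀ _ hR, sub_add_cancel]
  rw [map_sub, h1, avg_apply, ← integral_sub hint (hU.integrable φ R x), ← integral_mul_const]
  refine norm_integral_le_of_norm_le ((hi.sub φ.integrable).norm.mul_const ‖x‖)
    (.of_forall fun u => ?_)
  rw [← sub_smul, norm_smul]
  gcongr
  exact hU.norm_le _ _

/-- Wide averages over two commuting flows kill the closed span of the coboundaries. -/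
theorem tendsto_avg_avg_zero (hU : IsContractionFlow U) (hV : IsContractionFlow V)
    (hUV : ∀ s t x, U s (V t x) = V t (U s x)) (φ : 𝓢(ℝ, ℂ)) {a : X}
    (ha : a ∈ closure (Submodule.span ℂ
      ({b | ∃ s x, b = U s x - x} ∪ {b | ∃ t x, b = V t x - x}) : Set X)) :
    Tendsto (fun n : ℕ => hU.avg φ (n + 1) (hV.avg φ (n + 1) a)) atTop (𝓝 0) := by
  set C := ∫ u, ‖φ u‖ with hC
  have hC0 : 0 ≤ C := integral_nonneg fun _ => norm_nonneg _
  have hb : ∀ (n : ℕ) x, ‖hU.avg φ (n + 1) (hV.avg φ (n + 1) x)‖ ≤ C * (C * ‖x‖) := fun n x =>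
    (hU.norm_avg_apply_le _ _ _).trans (by gcongr; exact hV.norm_avg_apply_le _ _ _)
  have hlim : ∀ s : ℝ, Tendsto (fun n : ℕ => ∫ u, ‖φ (u - s / (n + 1)) - φ u‖) atTop (𝓝 0) := by
    intro s
    refine (tendsto_integral_norm_translate_sub φ).comp ?_
    simpa [div_eq_mul_inv] using (tendsto_one_div_add_atTop_nhds_zero_nat (𝕜 := ℝ)).const_mul s
  have hspan : ∀ m ∈ Submodule.span ℂ
      ({b | ∃ s x, b = U s x - x} ∪ {b | ∃ t x, b = V t x - x}),
      Tendsto (fun n : ℕ => hU.avg φ (n + 1) (hV.avg φ (n + 1) m)) atTop (𝓝 0) := by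
    intro m hm
    induction hm using Submodule.span_induction with
    | mem m hm =>
      rcases hm with ⟨s, x, rfl⟩ | ⟨t, x, rfl⟩
      · refine squeeze_zero_norm (a := fun n : ℕ =>
          (∫ u, ‖φ (u - s / (n + 1)) - φ u‖) * (C * ‖x‖)) (fun n => ?_) ?_
        · rw [map_sub (hV.avg φ _), ← hV.avg_comm φ _ (U s) (hUV s)]
          refine (hU.norm_avg_sub_le φ (by positivity) s _).trans ?_
          gcongr
          exact hV.norm_avg_apply_le _ _ _
        · simpa using (hlim s).mul_const (C * ‖x‖)
      · refine squeeze_zero_norm (a := fun n : ℕ =>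
          C * ((∫ u, ‖φ (u - t / (n + 1)) - φ u‖) * ‖x‖)) (fun n => ?_) ?_
        · refine (hU.norm_avg_apply_le _ _ _).trans ?_
          gcongr
          exact hV.norm_avg_sub_le φ (by positivity) t _
        · simpa using ((hlim t).mul_const ‖x‖).const_mul C
    | zero => simp
    | add x y _ _ hx hy => simpa using hx.add hy
    | smul c x _ hx => simpa using hx.const_smul c
  rw [Metric.tendsto_atTop]
  intro ε hε
  obtain ⟨m, hm, hma⟩ := Metric.mem_closure_iff.1 ha (ε / 2 / (C * C + 1)) (by positivity)
  obtain ⟨N, hN⟩ := Metric.tendsto_atTop.1 (hspan m hm) (ε / 2) (by positivity)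
  refine ⟨N, fun n hn => ?_⟩
  have h1 := hN n hn
  have h2 := hb n (a - m)
  rw [dist_eq_norm, lt_div_iff₀ (by positivity)] at hma
  rw [dist_zero_right] at h1 ⊢
  rw [map_sub, map_sub] at h2
  have h3 := norm_le_norm_add_norm_sub' (hU.avg φ (n + 1) (hV.avg φ (n + 1) a))
    (hU.avg φ (n + 1) (hV.avg φ (n + 1) m))
  nlinarith [norm_nonneg (a - m)]

end FlowAverage

namespace WeylSystem

open scoped Topology

variable (S : WeylSystem H)

theorem star_W_W (z : ℝ × ℝ) (x : H) : star (S.W z) (S.W z x) = x := by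
  have := Unitary.star_mul_self_of_mem (S.unitary_mem z)
  exact DFunLike.congr_fun this x

theorem W_star_W (z : ℝ × ℝ) (x : H) : S.W z (star (S.W z) x) = x := by
  have := Unitary.mul_star_self_of_mem (S.unitary_mem z)
  exact DFunLike.congr_fun this x

theorem inner_star_W_left (z : ℝ × ℝ) (x y : H) :
    @inner ℂ _ _ (star (S.W z) x) y = @inner ℂ _ _ x (S.W z y) :=
  ContinuousLinearMap.adjoint_inner_left _ _ _

theorem inner_star_W_right (z : ℝ × ℝ) (x y : H) :
    @inner ℂ _ _ x (star (S.W z) y) = @inner ℂ _ _ (S.W z x) y :=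
  ContinuousLinearMap.adjoint_inner_right _ _ _

theorem inner_W_W (z : ℝ × ℝ) (x y : H) :
    @inner ℂ _ _ (S.W z x) (S.W z y) = @inner ℂ _ _ x y := by
  rw [← inner_star_W_right, star_W_W]

theorem norm_W (z : ℝ × ℝ) (x : H) : ‖S.W z x‖ = ‖x‖ := by
  rw [@norm_eq_sqrt_re_inner ℂ, inner_W_W, ← @norm_eq_sqrt_re_inner ℂ]

theorem norm_star_W (z : ℝ × ℝ) (x : H) : ‖star (S.W z) x‖ = ‖x‖ := by
  rw [← S.norm_W z, W_star_W]

theorem W_W (z w : ℝ × ℝ) (x : H) :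
    S.W z (S.W w x) = Complex.exp (Complex.I * (symp z w : ℂ)) • S.W (z + w) x :=
  DFunLike.congr_fun (S.weyl z w) x

theorem W_comm (z w : ℝ × ℝ) (x : H) :
    S.W z (S.W w x) = Complex.exp (Complex.I * (2 * symp z w : ℝ)) • S.W w (S.W z x) := by
  rw [W_W, W_W, smul_smul, ← Complex.exp_add, add_comm w z]
  congr 2
  simp only [symp]
  push_cast
  ring

theorem star_exp_mul_exp (r : ℝ) :
    star (Complex.exp (Complex.I * (r : ℂ))) * Complex.exp (Complex.I * (r : ℂ)) = 1 := by
  rw [Complex.star_def, ← Complex.exp_conj, ← Complex.exp_add]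
  simp

/-- Conjugation by `W_z` on the projective tensor product. -/
def ad (z : ℝ × ℝ) : NuclearSpace H →L[ℂ] NuclearSpace H :=
  nuclearLift (tensSL.bilinearComp (S.W z) (S.W z))

@[simp]
theorem ad_tens (z : ℝ × ℝ) (x y : H) : S.ad z (tens x y) = tens (S.W z x) (S.W z y) := by
  simp [ad]

theorem ad_add (z w : ℝ × ℝ) (b : NuclearSpace H) : S.ad (z + w) b = S.ad z (S.ad w b) := by
  suffices S.ad (z + w) = (S.ad z).comp (S.ad w) from DFunLike.congr_fun this b
  refine NuclearSpace.ext_tens fun x y => ?_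
  simp only [ContinuousLinearMap.comp_apply, ad_tens, W_W]
  rw [tens_smul_left, tens_smul_right, smul_smul, star_exp_mul_exp, one_smul]

theorem norm_ad_le (z : ℝ × ℝ) (b : NuclearSpace H) : ‖S.ad z b‖ ≤ ‖b‖ := by
  refine le_of_forall_pos_le_add fun δ hδ => ?_
  obtain ⟨ξ, η, hs, hle, hb⟩ := exists_hasSum_tens b hδ
  have h := hb.mapL (S.ad z)
  rw [← h.tsum_eq]
  refine (tsum_of_norm_bounded hs.hasSum fun n => ?_).trans hle
  rw [ad_tens, ← S.norm_W z (ξ n), ← S.norm_W z (η n)]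
  exact norm_tens_le _ _

theorem continuous_ad (b : NuclearSpace H) : Continuous fun z => S.ad z b := by
  obtain ⟨ξ, η, hs, -, hb⟩ := exists_hasSum_tens b one_pos
  have h : (fun z => S.ad z b) = fun z => ∑' n, tens (S.W z (ξ n)) (S.W z (η n)) := by
    ext z
    rw [← (hb.mapL (S.ad z)).tsum_eq]
    simp
  rw [h]
  refine continuous_tsum (fun n => ?_) hs fun n z => ?_
  · simp only [← tensSL_apply]
    exact (tensSL.continuous.comp (S.strong_cont (ξ n))).clm_apply (S.strong_cont (η n))
  · rw [← S.norm_W z (ξ n), ← S.norm_W z (η n)]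
    exact norm_tens_le _ _

theorem isContractionFlow_fst : IsContractionFlow fun s : ℝ => S.ad (s, 0) where
  cont b := (S.continuous_ad b).comp (by fun_prop)
  norm_le _ _ := S.norm_ad_le _ _
  add s t b := by rw [← ad_add]; simp

theorem isContractionFlow_snd : IsContractionFlow fun t : ℝ => S.ad (0, t) where
  cont b := (S.continuous_ad b).comp (by fun_prop)
  norm_le _ _ := S.norm_ad_le _ _
  add s t b := by rw [← ad_add]; simp

/-- The functional `b ↦ trace (b W_z)`. -/
def fourier (z : ℝ × ℝ) : NuclearSpace H →L[ℂ] ℂ :=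
  nuclearLift ((innerSL ℂ).bilinearComp (.id ℂ H) (S.W z))

@[simp]
theorem fourier_tens (z : ℝ × ℝ) (x y : H) :
    S.fourier z (tens x y) = @inner ℂ _ _ x (S.W z y) := by
  simp [fourier]

theorem fourier_ad (z w : ℝ × ℝ) (b : NuclearSpace H) :
    S.fourier z (S.ad w b) = Complex.exp (Complex.I * (2 * symp z w : ℝ)) * S.fourier z b := by
  suffices (S.fourier z).comp (S.ad w) =
      Complex.exp (Complex.I * (2 * symp z w : ℝ)) • S.fourier z from DFunLike.congr_fun this b
  refine NuclearSpace.ext_tens fun x y => ?_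
  simp only [ContinuousLinearMap.comp_apply, ad_tens, fourier_tens, smul_apply]
  rw [W_comm, inner_smul_right, inner_W_W, smul_eq_mul]

/-- Evaluation at `v` of the operator represented by an element of the projective tensor
product. -/
def nuclearEval (v : H) : NuclearSpace H →L[ℂ] H :=
  nuclearLift ((ContinuousLinearMap.lsmul ℂ ℂ).comp ((innerSL ℂ).flip v))

@[simp]
theorem nuclearEval_tens (v x y : H) :
    nuclearEval v (tens x y) = @inner ℂ _ _ x v • y := by
  simp [nuclearEval]

/-- By irreducibility, an `ad`-invariant functional is a multiple of the trace. -/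
theorem Irreducible.exists_eq_mul_inner {S : WeylSystem H} (hS : S.Irreducible)
    (f : NuclearSpace H →L[ℂ] ℂ) (hf : ∀ z b, f (S.ad z b) = f b) :
    ∃ c : ℂ, ∀ x y, f (tens x y) = c * @inner ℂ _ _ x y := by
  let B : H →L⋆[ℂ] H →L[ℂ] ℂ := (ContinuousLinearMap.compL ℂ H (NuclearSpace H) ℂ f).comp tensSL
  let T := InnerProductSpace.continuousLinearMapOfBilin B
  have hT : ∀ x y, @inner ℂ _ _ (T x) y = f (tens x y) :=
    InnerProductSpace.continuousLinearMapOfBilin_apply B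
  obtain ⟨c, hc⟩ := hS T fun z => by
    ext x
    refine ext_inner_right ℂ fun y => ?_
    change @inner ℂ _ _ (T (S.W z x)) y = @inner ℂ _ _ (S.W z (T x)) y
    rw [← S.inner_star_W_right, hT, hT, ← hf z (tens x _), ad_tens, W_star_W]
  refine ⟨star c, fun x y => ?_⟩
  rw [← hT, hc]
  simp [mul_comm]

theorem Irreducible.mem_closure_span {S : WeylSystem H} (hS : S.Irreducible)
    {ξ η : ℕ → H} {a : NuclearSpace H} (ha : HasSum (fun n => tens (ξ n) (η n)) a)
    (h0 : ∑' n, @inner ℂ _ _ (ξ n) (η n) = 0) :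
    a ∈ closure (Submodule.span ℂ
      ({b | ∃ (s : ℝ) (x : NuclearSpace H), b = S.ad (s, 0) x - x} ∪
       {b | ∃ (t : ℝ) (x : NuclearSpace H), b = S.ad (0, t) x - x}) : Set (NuclearSpace H)) := by
  set M := Submodule.span ℂ
      ({b | ∃ (s : ℝ) (x : NuclearSpace H), b = S.ad (s, 0) x - x} ∪
       {b | ∃ (t : ℝ) (x : NuclearSpace H), b = S.ad (0, t) x - x})
  by_contra hcl
  have hne : ‖M.mkQL a‖ ≠ 0 := fun h =>
    hcl ((QuotientAddGroup.norm_mk_eq_zero_iff_mem_closure (S := M.toAddSubgroup)).1 h)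
  obtain ⟨g, -, hg⟩ := exists_dual_vector ℂ (M.mkQL a) hne
  let f := g.comp M.mkQL
  have hfM : ∀ m ∈ M, f m = 0 := fun m hm => by
    have : M.mkQL m = 0 :=
      (Submodule.Quotient.mk_eq_zero _).2 hm
    change g (M.mkQL m) = 0
    rw [this, map_zero]
  have h1 : ∀ (s : ℝ) b, f (S.ad (s, 0) b) = f b := fun s b => by
    rw [← sub_eq_zero, ← map_sub]
    exact hfM _ (Submodule.subset_span (.inl ⟨s, b, rfl⟩))
  have h2 : ∀ (t : ℝ) b, f (S.ad (0, t) b) = f b := fun t b => by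
    rw [← sub_eq_zero, ← map_sub]
    exact hfM _ (Submodule.subset_span (.inr ⟨t, b, rfl⟩))
  obtain ⟨c, hc⟩ := hS.exists_eq_mul_inner f fun z b => by
    have : z = (z.1, 0) + (0, z.2) := by simp
    rw [this, ad_add, h1, h2]
  have h3 := (ha.mapL f).tsum_eq
  simp only [hc, tsum_mul_left, h0, mul_zero] at h3
  exact hne (Complex.ofReal_eq_zero.1 (hg.symm.trans h3.symm))

open scoped SchwartzMap in
theorem fourier_avg_avg {φ : 𝓢(ℝ, ℂ)}
    (hφ : ∀ κ : ℝ, |κ| ≤ 1 → ∫ u, φ u * Complex.exp (Complex.I * (u * κ : ℝ)) = 1)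
    (R : ℝ) (z : ℝ × ℝ) (h1 : |R * z.1| ≤ 1) (h2 : |R * z.2| ≤ 1) (b : NuclearSpace H) :
    S.fourier z (S.isContractionFlow_fst.avg φ R (S.isContractionFlow_snd.avg φ R b)) =
      S.fourier z b := by
  rw [S.isContractionFlow_fst.map_avg_of_eigen φ R _ z.2, hφ _ h2, one_mul,
    S.isContractionFlow_snd.map_avg_of_eigen φ R _ (-z.1), hφ _ (by simpa using h1), one_mul]
  · intro t x
    rw [fourier_ad]
    congr 4
    simp only [symp]
    ring
  · intro t x
    rw [fourier_ad]
    congr 4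
    simp only [symp]
    ring

end WeylSystem

/-- Noncommutative Beurling theorem.  If `A` is a trace-class operator on a
separable Hilbert space `H` (given by a nuclear representation `A x = ∑' n, ⟨ξ₀ n, x⟩ • η₀ n`
with `∑ ‖ξ₀ n‖‖η₀ n‖ < ∞`) whose transform `Â(z) = trace (A W_z) = ∑' n, ⟨ξ₀ n, W_z (η₀ n)⟩`
vanishes at `ζ`, then there are trace-class operators `Aₙ` (given by nuclear representations)
and open neighborhoods `Uₙ` of `ζ` with `trace (Aₙ W_z) = 0` for all `z ∈ Uₙ`, and
`trace |A − Aₙ| → 0` (the trace norm being the infimum of `∑ ‖ξ'‖‖η'‖` over nuclear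
representations of `A − Aₙ`). -/
theorem ccr_beurling [TopologicalSpace.SeparableSpace H]
    (S : WeylSystem H) (hS : S.Irreducible)
    (A : H →L[ℂ] H) (ξ₀ η₀ : ℕ → H) (hsum : Summable fun n => ‖ξ₀ n‖ * ‖η₀ n‖)
    (hA : ∀ x, A x = ∑' n, @inner ℂ _ _ (ξ₀ n) x • η₀ n)
    (ζ : ℝ × ℝ) (hζ : ∑' n, @inner ℂ _ _ (ξ₀ n) ((S.W ζ) (η₀ n)) = 0) :
    ∃ (ξ η : ℕ → ℕ → H) (U : ℕ → Set (ℝ × ℝ)),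
      (∀ n, IsOpen (U n) ∧ ζ ∈ U n) ∧
      (∀ n, Summable fun k => ‖ξ n k‖ * ‖η n k‖) ∧
      (∀ n, ∀ z ∈ U n, ∑' k, @inner ℂ _ _ (ξ n k) ((S.W z) (η n k)) = 0) ∧
      (∀ ε > (0 : ℝ), ∃ N, ∀ n ≥ N, ∃ ξ' η' : ℕ → H,
        (∀ x, A x - ∑' k, @inner ℂ _ _ (ξ n k) x • η n k = ∑' m, @inner ℂ _ _ (ξ' m) x • η' m) ∧
        Summable (fun m => ‖ξ' m‖ * ‖η' m‖) ∧ ∑' m, ‖ξ' m‖ * ‖η' m‖ ≤ ε) := by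
  obtain ⟨φ, hφ⟩ := exists_schwartz_integral_mul_exp_eq_one
  have hsummable : Summable fun n => tens (star (S.W ζ) (ξ₀ n)) (η₀ n) := by
    refine .of_norm_bounded hsum fun n => ?_
    rw [← S.norm_star_W ζ (ξ₀ n)]
    exact norm_tens_le _ _
  obtain ⟨a, ha⟩ := hsummable
  have hlim := tendsto_avg_avg_zero S.isContractionFlow_fst S.isContractionFlow_snd
    (fun s t x => by rw [← S.ad_add, ← S.ad_add, add_comm]) φ
    (hS.mem_closure_span ha (by simpa only [S.inner_star_W_left] using hζ))
  set d : ℕ → NuclearSpace H := fun n =>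
    S.isContractionFlow_fst.avg φ (n + 1) (S.isContractionFlow_snd.avg φ (n + 1) a) with hd
  choose ξ η hs _ hb using fun n => exists_hasSum_tens (a - d n) one_pos
  have heval : ∀ {ξ η : ℕ → H} {b : NuclearSpace H}, HasSum (fun n => tens (ξ n) (η n)) b →
      ∀ x, ∑' k, @inner ℂ _ _ (S.W ζ (ξ k)) x • η k =
        WeylSystem.nuclearEval (star (S.W ζ) x) b := fun {ξ η b} h x => by
    rw [← (h.mapL (WeylSystem.nuclearEval (star (S.W ζ) x))).tsum_eq]
    simp only [WeylSystem.nuclearEval_tens, S.inner_star_W_right]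
  refine ⟨fun n k => S.W ζ (ξ n k), η,
    fun n => {z | |((n : ℝ) + 1) * (z - ζ).1| < 1} ∩ {z | |((n : ℝ) + 1) * (z - ζ).2| < 1},
    fun n => ⟨?_, ?_⟩, fun n => ?_, fun n z hz => ?_, fun ε hε => ?_⟩
  · exact (isOpen_lt (by fun_prop) continuous_const).inter
      (isOpen_lt (by fun_prop) continuous_const)
  · simp
  · simpa only [S.norm_W] using hs n
  · have hW : ∀ x y, @inner ℂ _ _ (S.W ζ x) (S.W z y) =
        Complex.exp (Complex.I * (symp z ζ : ℂ)) * @inner ℂ _ _ x (S.W (z - ζ) y) := by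
      intro x y
      have h := S.W_W ζ (z - ζ) y
      rw [add_sub_cancel] at h
      rw [← S.inner_W_W ζ x, h, inner_smul_right, ← mul_assoc, ← Complex.exp_add, ← mul_add,
        show ((symp z ζ : ℂ) + (symp ζ (z - ζ) : ℂ)) = 0 by
          rw [← Complex.ofReal_add, Complex.ofReal_eq_zero]
          simp only [symp, Prod.fst_sub, Prod.snd_sub]
          ring]
      simp
    have h0 := ((hb n).mapL (S.fourier (z - ζ))).tsum_eq
    simp only [S.fourier_tens] at h0
    simp only [hW, tsum_mul_left, h0]
    rw [map_sub, hd, S.fourier_avg_avg hφ _ _ hz.1.le hz.2.le, sub_self, mul_zero]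
  · obtain ⟨N, hN⟩ := Metric.tendsto_atTop.1 hlim (ε / 2) (by positivity)
    refine ⟨N, fun n hn => ?_⟩
    obtain ⟨ξ', η', hs', hle, hb'⟩ := exists_hasSum_tens (d n) (half_pos hε)
    refine ⟨fun k => S.W ζ (ξ' k), η', fun x => ?_, ?_, ?_⟩
    · have hAx : A x = WeylSystem.nuclearEval (star (S.W ζ) x) a := by
        rw [hA, ← heval ha]
        simp only [S.W_star_W]
      rw [hAx, heval (hb n), heval hb', map_sub, sub_sub_cancel]
    · simpa only [S.norm_W] using hs'
    · have := hN n hn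
      rw [dist_zero_right] at this
      simp only [S.norm_W]
      linarith
end
end

section
/- Let μ_t be the Gaussian probability measure on ℝ² with density u_t(x,y) = (1/(πt)) e^{−(x²+y²)/(4t)}, and let f_t = √u_t. Then for any g ∈ L¹(ℝ²) whose Fourier transform ĝ satisfies 0 ≤ ĝ ≤ 1 and ĝ = 1 on a neighborhood of 0, one has ‖f_t − g * f_t‖_{L²(ℝ²)} → 0 as t → ∞. -/
open MeasureTheory Complex Filter
open scoped ComplexOrder

noncomputable section

variable (H : Type) [NormedAddCommGroup H] [InnerProductSpace ℂ H] [CompleteSpace H]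

variable {H}

/-- The square root `f_t = √u_t` of the Gaussian density
`u_t(x,y) = (πt)⁻¹ e^{−(x²+y²)/(4t)}`, as a complex-valued function on `ℝ²`. -/
def gaussAmp (t : ℝ) (p : ℝ × ℝ) : ℂ :=
  (Real.sqrt ((Real.pi * t)⁻¹ * Real.exp (-(p.1 ^ 2 + p.2 ^ 2) / (4 * t))) : ℝ)

/-- The density `u_t(x,y) = (πt)⁻¹ e^{−(x²+y²)/(4t)}`. -/
def gaussDensity (t : ℝ) (p : ℝ × ℝ) : ℝ :=
  (Real.pi * t)⁻¹ * Real.exp (-(p.1 ^ 2 + p.2 ^ 2) / (4 * t))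

lemma gaussDensity_eq_mul (t : ℝ) (p : ℝ × ℝ) :
    gaussDensity t p = (Real.pi * t)⁻¹ *
      (Real.exp (-(4 * t)⁻¹ * p.1 ^ 2) * Real.exp (-(4 * t)⁻¹ * p.2 ^ 2)) := by
  rw [gaussDensity, ← Real.exp_add]
  congr 2
  ring

lemma integrable_gaussDensity {t : ℝ} (ht : 0 < t) : Integrable (gaussDensity t) := by
  have h := integrable_exp_neg_mul_sq (b := (4 * t)⁻¹) (by positivity)
  rw [funext (gaussDensity_eq_mul t)]
  exact (h.mul_prod h).const_mul _

lemma integral_gaussDensity {t : ℝ} (ht : 0 < t) : ∫ p, gaussDensity t p = 4 := by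
  simp_rw [gaussDensity_eq_mul]
  rw [integral_const_mul, Measure.volume_eq_prod,
    integral_prod_mul (fun x : ℝ => Real.exp (-(4 * t)⁻¹ * x ^ 2))
      (fun x : ℝ => Real.exp (-(4 * t)⁻¹ * x ^ 2)),
    integral_gaussian, Real.mul_self_sqrt (by positivity)]
  have := Real.pi_pos
  field_simp

lemma sqrt_gaussDensity_mul_sqrt_translate {t : ℝ} (ht : 0 < t) (p q : ℝ × ℝ) :
    √(gaussDensity t p) * √(gaussDensity t (p - q)) =
      Real.exp (-(q.1 ^ 2 + q.2 ^ 2) / (16 * t)) *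
        gaussDensity t (p - (2⁻¹ : ℝ) • q) := by
  have hpi := Real.pi_pos
  rw [← Real.sqrt_mul (by unfold gaussDensity; positivity)]
  rw [Real.sqrt_eq_iff_mul_self_eq (by unfold gaussDensity; positivity)
    (by unfold gaussDensity; positivity)]
  simp only [gaussDensity, Prod.fst_sub, Prod.snd_sub, Prod.smul_fst, Prod.smul_snd, smul_eq_mul]
  have h : ∀ c a b x y : ℝ, 2 * (a + b) = x + y →
      Real.exp a * (c * Real.exp b) * (Real.exp a * (c * Real.exp b)) =
        c * Real.exp x * (c * Real.exp y) := by
    intro c a b x y hab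
    have : Real.exp a * Real.exp b * (Real.exp a * Real.exp b) = Real.exp x * Real.exp y := by
      simp only [← Real.exp_add]
      congr 1
      linarith
    linear_combination c ^ 2 * this
  refine (h _ _ _ _ _ ?_).symm
  field_simp
  ring

lemma continuous_gaussAmp (t : ℝ) : Continuous (gaussAmp t) := by
  unfold gaussAmp
  fun_prop

/-- The squared `L²` distance between `√u_t` and its translate by `q`. -/
lemma lintegral_gaussAmp_sub_translate_sq {t : ℝ} (ht : 0 < t) (q : ℝ × ℝ) :
    ∫⁻ p, ‖gaussAmp t p - gaussAmp t (p - q)‖ₑ ^ 2 =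
      ENNReal.ofReal (8 * (1 - Real.exp (-(q.1 ^ 2 + q.2 ^ 2) / (16 * t)))) := by
  set e := Real.exp (-(q.1 ^ 2 + q.2 ^ 2) / (16 * t)) with he
  have hnonneg : ∀ p, 0 ≤ gaussDensity t p := fun p => by
    have := Real.pi_pos
    unfold gaussDensity; positivity
  have hexpand : ∀ p, (√(gaussDensity t p) - √(gaussDensity t (p - q))) ^ 2 =
      gaussDensity t p + gaussDensity t (p - q) -
        2 * e * gaussDensity t (p - (2⁻¹ : ℝ) • q) := by
    intro p
    have h := sqrt_gaussDensity_mul_sqrt_translate ht p q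
    have h1 := Real.sq_sqrt (hnonneg p)
    have h2 := Real.sq_sqrt (hnonneg (p - q))
    linear_combination h1 + h2 - 2 * h
  have hU := integrable_gaussDensity ht
  have h1 := hU.add (hU.comp_sub_right q)
  have h2 := (hU.comp_sub_right ((2⁻¹ : ℝ) • q)).const_mul (2 * e)
  have hint : Integrable fun p => (√(gaussDensity t p) - √(gaussDensity t (p - q))) ^ 2 := by
    simp_rw [hexpand]
    exact h1.sub h2
  have hval : ∫ p, (√(gaussDensity t p) - √(gaussDensity t (p - q))) ^ 2 = 8 * (1 - e) := by
    simp_rw [hexpand]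
    rw [integral_sub (by exact h1) h2, integral_add hU (hU.comp_sub_right q), integral_const_mul,
      integral_sub_right_eq_self (gaussDensity t), integral_sub_right_eq_self (gaussDensity t),
      integral_gaussDensity ht]
    ring
  rw [← hval, ofReal_integral_eq_lintegral_ofReal hint (ae_of_all _ fun p => sq_nonneg _)]
  refine lintegral_congr fun p => ?_
  have : gaussAmp t p - gaussAmp t (p - q) =
      ((√(gaussDensity t p) - √(gaussDensity t (p - q)) : ℝ) : ℂ) := by
    simp [gaussAmp, gaussDensity]
  rw [this, ← ofReal_norm, ← ENNReal.ofReal_pow (norm_nonneg _), Complex.norm_real,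
    Real.norm_eq_abs, sq_abs]

/-- Cauchy–Schwarz for the measure with density `a`. -/
lemma lintegral_mul_sq_le {α : Type*} [MeasurableSpace α] {μ : Measure α} {a b : α → ENNReal}
    (ha : AEMeasurable a μ) (hb : AEMeasurable b μ) :
    (∫⁻ x, a x * b x ∂μ) ^ 2 ≤ (∫⁻ x, a x ∂μ) * ∫⁻ x, a x * b x ^ 2 ∂μ := by
  have hsq : ∀ x : ENNReal, (x ^ (2⁻¹ : ℝ)) ^ (2 : ℝ) = x := fun x => by
    rw [← ENNReal.rpow_mul]; norm_num
  have hmul : ∀ x : ENNReal, x ^ (2⁻¹ : ℝ) * x ^ (2⁻¹ : ℝ) = x := fun x => by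
    rw [← sq, ← ENNReal.rpow_natCast]; exact_mod_cast hsq x
  have h := ENNReal.lintegral_mul_le_Lp_mul_Lq μ Real.HolderConjugate.two_two
    (ha.pow_const (2⁻¹ : ℝ)) ((ha.pow_const (2⁻¹ : ℝ)).mul hb)
  simp only [Pi.mul_apply, ← mul_assoc, hmul, hsq,
    ENNReal.mul_rpow_of_nonneg _ _ (zero_le_two : (0 : ℝ) ≤ 2), one_div] at h
  rw [← ENNReal.mul_rpow_of_nonneg _ _ (by norm_num)] at h
  calc (∫⁻ x, a x * b x ∂μ) ^ 2 ≤ _ := pow_le_pow_left' h 2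
    _ = _ := by
      rw [← ENNReal.rpow_natCast]
      simp only [Nat.cast_ofNat, hsq, ENNReal.rpow_two]

lemma integrable_mul_gaussAmp_translate {g : ℝ × ℝ → ℂ} (hg : Integrable g) {t : ℝ} (ht : 0 < t)
    (p : ℝ × ℝ) : Integrable fun q => g q * gaussAmp t (p - q) := by
  have hpi := Real.pi_pos
  refine hg.mul_bdd (c := √((Real.pi * t)⁻¹))
    ((continuous_gaussAmp t).comp (by fun_prop)).aestronglyMeasurable (ae_of_all _ fun q => ?_)
  rw [gaussAmp, Complex.norm_real, Real.norm_of_nonneg (Real.sqrt_nonneg _)]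
  refine Real.sqrt_le_sqrt (mul_le_of_le_one_right (by positivity) (Real.exp_le_one_iff.2 ?_))
  rw [neg_div, neg_nonpos]
  positivity

lemma lintegral_gaussAmp_sub_convolution_sq_le {g : ℝ × ℝ → ℂ} (hg : Integrable g)
    (hg1 : ∫ q, g q = 1) {t : ℝ} (ht : 0 < t) :
    ∫⁻ p, ‖gaussAmp t p - ∫ q, g q * gaussAmp t (p - q)‖ₑ ^ 2 ≤
      (∫⁻ q, ‖g q‖ₑ) * ∫⁻ q, ‖g q‖ₑ *
        ENNReal.ofReal (8 * (1 - Real.exp (-(q.1 ^ 2 + q.2 ^ 2) / (16 * t)))) := by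
  have hf := continuous_gaussAmp t
  have hpoint : ∀ p, ‖gaussAmp t p - ∫ q, g q * gaussAmp t (p - q)‖ₑ ^ 2 ≤
      (∫⁻ q, ‖g q‖ₑ) * ∫⁻ q, ‖g q‖ₑ * ‖gaussAmp t p - gaussAmp t (p - q)‖ₑ ^ 2 := by
    intro p
    have heq : gaussAmp t p - ∫ q, g q * gaussAmp t (p - q) =
        ∫ q, g q * (gaussAmp t p - gaussAmp t (p - q)) := by
      simp_rw [mul_sub]
      rw [integral_sub (hg.mul_const _) (integrable_mul_gaussAmp_translate hg ht p),
        integral_mul_const, hg1, one_mul]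
    rw [heq]
    refine (pow_le_pow_left' (enorm_integral_le_lintegral_enorm _) 2).trans ?_
    simp_rw [enorm_mul]
    exact lintegral_mul_sq_le hg.1.enorm
      (by fun_prop : Continuous fun q => ‖gaussAmp t p - gaussAmp t (p - q)‖ₑ).aemeasurable
  have hmeas : Measurable fun z : (ℝ × ℝ) × (ℝ × ℝ) =>
      ‖gaussAmp t z.1 - gaussAmp t (z.1 - z.2)‖ₑ ^ 2 :=
    (by fun_prop : Continuous fun z : (ℝ × ℝ) × (ℝ × ℝ) =>
      ‖gaussAmp t z.1 - gaussAmp t (z.1 - z.2)‖ₑ).measurable.pow_const 2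
  refine (lintegral_mono hpoint).trans_eq ?_
  rw [lintegral_const_mul' _ _ hg.2.ne,
    lintegral_lintegral_swap ((hg.1.enorm.comp_snd).mul hmeas.aemeasurable)]
  congr 1
  refine lintegral_congr fun q => ?_
  rw [lintegral_const_mul' _ _ enorm_ne_top, lintegral_gaussAmp_sub_translate_sq ht]

lemma tendsto_lintegral_enorm_mul_one_sub_exp {g : ℝ × ℝ → ℂ} (hg : Integrable g) :
    Tendsto (fun t : ℝ => ∫⁻ q, ‖g q‖ₑ *
      ENNReal.ofReal (8 * (1 - Real.exp (-(q.1 ^ 2 + q.2 ^ 2) / (16 * t)))))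
      atTop (nhds 0) := by
  rw [← lintegral_zero (α := ℝ × ℝ) (μ := volume)]
  refine tendsto_lintegral_filter_of_dominated_convergence' (fun q => ‖g q‖ₑ * ENNReal.ofReal 8)
    (.of_forall fun t => hg.1.enorm.mul (by fun_prop)) (.of_forall fun t => ae_of_all _ fun q => ?_)
    ?_ (ae_of_all _ fun q => ?_)
  · gcongr
    linarith [Real.exp_pos (-(q.1 ^ 2 + q.2 ^ 2) / (16 * t))]
  · rw [lintegral_mul_const' _ _ ENNReal.ofReal_ne_top]
    exact ENNReal.mul_ne_top hg.2.ne ENNReal.ofReal_ne_top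
  · have h1 : Tendsto (fun t : ℝ => -(q.1 ^ 2 + q.2 ^ 2) / (16 * t)) atTop (nhds 0) :=
      tendsto_const_nhds.div_atTop (tendsto_id.const_mul_atTop (by norm_num))
    have h2 := ENNReal.tendsto_ofReal
      (((Real.continuous_exp.tendsto 0).comp h1).const_sub 1 |>.const_mul 8)
    have h3 := ENNReal.Tendsto.const_mul (a := ‖g q‖ₑ) h2 (Or.inr enorm_ne_top)
    simpa using h3

/-- For `f_t = √u_t` and any `g ∈ L¹(ℝ²)` whose symplectic Fourier transform `ĝ`
is real with `0 ≤ ĝ ≤ 1` and `ĝ = 1` on a neighborhood of `0`, one has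
`‖f_t − g * f_t‖_{L²(ℝ²)} → 0` as `t → ∞`. -/
theorem gaussian_sqrt_convolution_approx
    (g : ℝ × ℝ → ℂ) (hg : Integrable g)
    (hreal : ∀ ζ : ℝ × ℝ,
      (∫ z : ℝ × ℝ, Complex.exp (Complex.I * ((symp ζ z : ℝ) : ℂ)) * g z).im = 0 ∧
      0 ≤ (∫ z : ℝ × ℝ, Complex.exp (Complex.I * ((symp ζ z : ℝ) : ℂ)) * g z).re ∧
      (∫ z : ℝ × ℝ, Complex.exp (Complex.I * ((symp ζ z : ℝ) : ℂ)) * g z).re ≤ 1)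
    (δ : ℝ) (hδ : 0 < δ)
    (hone : ∀ ζ : ℝ × ℝ, ‖ζ‖ ≤ δ →
      ∫ z : ℝ × ℝ, Complex.exp (Complex.I * ((symp ζ z : ℝ) : ℂ)) * g z = 1) :
    Tendsto (fun t : ℝ =>
        eLpNorm (fun p : ℝ × ℝ => gaussAmp t p - ∫ q : ℝ × ℝ, g q * gaussAmp t (p - q)) 2 volume)
      atTop (nhds 0) := by
  have hg1 : ∫ q, g q = 1 := by
    simpa [symp] using hone 0 (by simpa using hδ.le)
  have hlim : Tendsto (fun t : ℝ =>
      ∫⁻ p, ‖gaussAmp t p - ∫ q, g q * gaussAmp t (p - q)‖ₑ ^ 2) atTop (nhds 0) := by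
    have hbound := ENNReal.Tendsto.const_mul (a := ∫⁻ q, ‖g q‖ₑ)
      (tendsto_lintegral_enorm_mul_one_sub_exp hg) (Or.inr hg.2.ne)
    rw [mul_zero] at hbound
    refine tendsto_of_tendsto_of_tendsto_of_le_of_le' tendsto_const_nhds hbound
      (.of_forall fun _ => zero_le) ?_
    filter_upwards [eventually_gt_atTop 0] with t ht
    exact lintegral_gaussAmp_sub_convolution_sq_le hg hg1 ht
  have hroot := hlim.ennrpow_const (1 / 2 : ℝ)
  rw [ENNReal.zero_rpow_of_pos (by norm_num)] at hroot
  simpa [eLpNorm_eq_lintegral_rpow_enorm_toReal two_ne_zero ENNReal.ofNat_ne_top] using hroot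
end
end
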